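/- arXiv:1701.03058 — 2 statements merged into one kernel-verified Lean document; each statement's English description precedes it below -/
import Mathlib

section
/- For all k+l ≤ i ≤ n and all real x, the modified Jacobi polynomial satisfies J_{i,k,l}^{(α,β)}(x) = Σ_{h=k}^{n-l} c_{ih} B_h^n(x), where c_{ih} := ((α+2l+1)_{i-k-l}/(i-k-l)!) · C(n,h)^{-1} · C(n-k-l, h-k) · Q_{i-k-l}(n-l-h; α+2l, β+2k, n-k-l). (Lemma 3.1: Bernstein form of the modified Jacobi polynomials, with coefficients given by Hahn polynomials.) -/
open Finset

/-- Pochhammer symbol `(x)_m = x (x+1) ⋯ (x+m-1)`. -/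
noncomputable def poch (x : ℝ) (m : ℕ) : ℝ := ∏ j ∈ Finset.range m, (x + j)

/-- Bernstein polynomial `B_j^n(x) = C(n,j) x^j (1-x)^(n-j)`. -/
noncomputable def bern (n j : ℕ) (x : ℝ) : ℝ := (n.choose j : ℝ) * x ^ j * (1 - x) ^ (n - j)

/-- Shifted Jacobi polynomial `R_i^(a,b)(x)`. -/
noncomputable def shiftedJacobi (a b : ℝ) (i : ℕ) (x : ℝ) : ℝ :=
  poch (a + 1) i / (Nat.factorial i : ℝ) *
    ∑ j ∈ Finset.range (i + 1),
      poch (-(i : ℝ)) j * poch ((i : ℝ) + a + b + 1) j /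
        ((Nat.factorial j : ℝ) * poch (a + 1) j) * (1 - x) ^ j

/-- Hahn polynomial `Q_m(t; a, b, N)`. -/
noncomputable def hahnQ (m : ℕ) (t : ℝ) (a b : ℝ) (N : ℕ) : ℝ :=
  ∑ j ∈ Finset.range (m + 1),
    poch (-(m : ℝ)) j * poch ((m : ℝ) + a + b + 1) j * poch (-t) j /
      ((Nat.factorial j : ℝ) * poch (a + 1) j * poch (-(N : ℝ)) j)

/-- Dual Hahn polynomial `R_m(λ(t); a, b, N)` with `λ(t) = t(t+a+b+1)`. -/
noncomputable def dualHahnR (m : ℕ) (t : ℝ) (a b : ℝ) (N : ℕ) : ℝ :=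
  ∑ j ∈ Finset.range (m + 1),
    poch (-(m : ℝ)) j * poch (t + a + b + 1) j * poch (-t) j /
      ((Nat.factorial j : ℝ) * poch (a + 1) j * poch (-(N : ℝ)) j)

/-- Modified Jacobi polynomial `J_{i,k,l}^(α,β)(x) = (1-x)^l x^k R_{i-k-l}^(α+2l,β+2k)(x)`. -/
noncomputable def modJacobi (α β : ℝ) (k l i : ℕ) (x : ℝ) : ℝ :=
  (1 - x) ^ l * x ^ k * shiftedJacobi (α + 2 * l) (β + 2 * k) (i - k - l) x

/-- Connection coefficient `c_{ih}` of the Bernstein form of the modified Jacobi polynomials. -/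
noncomputable def cCoef (α β : ℝ) (n k l i h : ℕ) : ℝ :=
  poch (α + 2 * l + 1) (i - k - l) / (Nat.factorial (i - k - l) : ℝ) *
    (n.choose h : ℝ)⁻¹ * ((n - k - l).choose (h - k) : ℝ) *
    hahnQ (i - k - l) ((n : ℝ) - l - h) (α + 2 * l) (β + 2 * k) (n - k - l)

/-- The quantity `z_{hi}`. -/
noncomputable def zCoef (α β : ℝ) (n k l h i : ℕ) : ℝ :=
  (n.choose h : ℝ) * (2 * (i : ℝ) + (α + β + 1)) * poch ((k : ℝ) + l - n) (i - k - l) *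
      poch (α + 2 * l + 1) (n - l - h) * poch (β + 2 * k + 1) (h - k) /
    (poch (α + 2 * l + 1) (i - k - l) * poch ((i : ℝ) + k + l + (α + β + 1)) (n + 1 - k - l))

/-- The quantity `w_{hi}`. -/
noncomputable def wCoef (α β : ℝ) (n k l h i : ℕ) : ℝ :=
  hahnQ (i - k - l) ((h : ℝ) - k) (β + 2 * k) (α + 2 * l) (n - k - l)

/-- Connection coefficient `d_{hi}` of the modified Jacobi form of Bernstein polynomials. -/
noncomputable def dCoef (α β : ℝ) (n k l h i : ℕ) : ℝ := zCoef α β n k l h i * wCoef α β n k l h i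

/-- Coefficient `a_{ih}^(m,a,b) = (-1)^i ((b+1)_i / i!) Q_i(h; b, a, m)`. -/
noncomputable def aCoef (m : ℕ) (a b : ℝ) (i h : ℕ) : ℝ :=
  (-1 : ℝ) ^ i * poch (b + 1) i / (Nat.factorial i : ℝ) * hahnQ i (h : ℝ) b a m

/-- Coefficient `b_{hi}^(m,a,b)`. -/
noncomputable def bCoef (m : ℕ) (a b : ℝ) (h i : ℕ) : ℝ :=
  (m.choose h : ℝ) * (2 * (i : ℝ) + a + b + 1) * poch (-(m : ℝ)) i * poch (a + 1) (m - h) *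
      poch (b + 1) h / (poch (a + 1) i * poch ((i : ℝ) + a + b + 1) (m + 1)) *
    hahnQ i (h : ℝ) b a m

theorem poch_neg_natCast (t j : ℕ) :
    poch (-(t : ℝ)) j = (-1 : ℝ) ^ j * (t.descFactorial j : ℝ) := by
  induction j with
  | zero => simp [poch]
  | succ j ih =>
    have h : poch (-(t : ℝ)) (j + 1) = poch (-(t : ℝ)) j * (-(t : ℝ) + j) := by
      simp [poch, Finset.prod_range_succ]
    rw [h, ih, Nat.descFactorial_succ]
    rcases le_or_gt j t with hj | hj
    · push_cast [Nat.cast_sub hj]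
      ring
    · simp [Nat.descFactorial_of_lt hj]

theorem poch_neg_natCast_ne_zero {N j : ℕ} (h : j ≤ N) : poch (-(N : ℝ)) j ≠ 0 := by
  rw [poch_neg_natCast]
  exact mul_ne_zero (by simp) (by exact_mod_cast (Nat.descFactorial_pos.2 h).ne')

theorem choose_mul_descFactorial {N s j : ℕ} (hs : s ≤ N) (hj : j ≤ N) :
    N.choose s * (N - s).descFactorial j = (N - j).choose s * N.descFactorial j := by
  rcases le_or_gt j (N - s) with h | h
  · have h1 := Nat.choose_mul (n := N) h
    rw [Nat.choose_symm hs] at h1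
    have h2 : (N - j).choose (N - s - j) = (N - j).choose s := by
      rw [show N - s - j = N - j - s by omega]
      exact Nat.choose_symm (by omega)
    rw [h2] at h1
    rw [Nat.descFactorial_eq_factorial_mul_choose, Nat.descFactorial_eq_factorial_mul_choose]
    linear_combination (j.factorial) * h1
  · rw [Nat.descFactorial_of_lt h, Nat.choose_eq_zero_of_lt (by omega : N - j < s), mul_zero,
      zero_mul]

/-- Bernstein form of a power of `1 - x`, with coefficients as quotients of Pochhammer symbols. -/
theorem one_sub_pow_eq_sum {N j : ℕ} (hj : j ≤ N) (x : ℝ) :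
    (1 - x) ^ j = ∑ s ∈ Finset.range (N + 1),
      (N.choose s : ℝ) * (poch (-((N - s : ℕ) : ℝ)) j / poch (-(N : ℝ)) j) *
        (x ^ s * (1 - x) ^ (N - s)) := by
  have hbin : (1 - x) ^ j = ∑ s ∈ Finset.range (N - j + 1),
      ((N - j).choose s : ℝ) * (x ^ s * (1 - x) ^ (N - s)) := by
    have h := add_pow x (1 - x) (N - j)
    rw [add_sub_cancel, one_pow] at h
    conv_lhs => rw [← mul_one ((1 - x) ^ j)]
    conv_lhs => arg 2; rw [h]
    rw [Finset.mul_sum]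
    refine Finset.sum_congr rfl fun s hs => ?_
    rw [Finset.mem_range] at hs
    rw [show N - s = j + (N - j - s) by omega, pow_add]
    ring
  rw [hbin]
  trans ∑ s ∈ Finset.range (N + 1), ((N - j).choose s : ℝ) * (x ^ s * (1 - x) ^ (N - s))
  · refine Finset.sum_subset (Finset.range_mono (by omega)) fun s _ hs => ?_
    rw [Finset.mem_range] at hs
    rw [Nat.choose_eq_zero_of_lt (by omega)]
    simp
  · refine Finset.sum_congr rfl fun s hs => ?_
    rw [Finset.mem_range] at hs
    have h : (N.choose s : ℝ) * ((N - s).descFactorial j : ℝ) =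
        ((N - j).choose s : ℝ) * (N.descFactorial j : ℝ) := by
      exact_mod_cast choose_mul_descFactorial (by omega : s ≤ N) hj
    congr 1
    rw [mul_div_assoc', eq_div_iff (poch_neg_natCast_ne_zero hj), poch_neg_natCast,
      poch_neg_natCast]
    linear_combination (-(-1 : ℝ) ^ j) * h

/-- Bernstein form of the shifted Jacobi polynomials, with Hahn polynomials as coefficients. -/
theorem shiftedJacobi_eq_sum (a b : ℝ) {m N : ℕ} (hm : m ≤ N) (x : ℝ) :
    shiftedJacobi a b m x = ∑ s ∈ Finset.range (N + 1),
      poch (a + 1) m / (m.factorial : ℝ) * (N.choose s : ℝ) *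
        hahnQ m ((N - s : ℕ) : ℝ) a b N * (x ^ s * (1 - x) ^ (N - s)) := by
  unfold shiftedJacobi hahnQ
  simp only [Finset.mul_sum, Finset.sum_mul]
  rw [Finset.sum_comm]
  refine Finset.sum_congr rfl fun j hj => ?_
  rw [Finset.mem_range] at hj
  rw [one_sub_pow_eq_sum (by omega : j ≤ N) x, Finset.mul_sum, Finset.mul_sum]
  refine Finset.sum_congr rfl fun s _ => ?_
  simp only [div_eq_mul_inv, mul_inv]
  ring

/-- Lemma 3.1: Bernstein form of the modified Jacobi polynomials. -/
theorem modJacobi_eq_sum_bernstein (α β : ℝ) (hα : -1 < α) (hβ : -1 < β)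
    (n k l : ℕ) (hkl : k + l ≤ n) :
    ∀ i : ℕ, k + l ≤ i → i ≤ n → ∀ x : ℝ,
      modJacobi α β k l i x = ∑ h ∈ Finset.Icc k (n - l), cCoef α β n k l i h * bern n h x := by
  intro i hi hin x
  unfold modJacobi
  rw [shiftedJacobi_eq_sum _ _ (by omega : i - k - l ≤ n - k - l), Finset.mul_sum,
    Finset.range_eq_Ico, show Finset.Icc k (n - l) = Finset.Ico (0 + k) (n - k - l + 1 + k) by
      ext h; simp only [Finset.mem_Icc, Finset.mem_Ico]; omega, ← Finset.sum_Ico_add']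
  refine Finset.sum_congr rfl fun s hs => ?_
  rw [Finset.mem_Ico] at hs
  have hc : (n.choose (s + k) : ℝ) ≠ 0 := by
    exact_mod_cast (Nat.choose_pos (by omega : s + k ≤ n)).ne'
  have ht : (n : ℝ) - l - ((s + k : ℕ) : ℝ) = ((n - k - l - s : ℕ) : ℝ) := by
    rw [show n = n - k - l - s + k + l + s by omega]
    push_cast [show n - k - l - s + k + l + s - k - l - s = n - k - l - s by omega]
    ring
  unfold cCoef bern
  rw [ht, Nat.add_sub_cancel, show n - (s + k) = n - k - l - s + l by omega, pow_add, pow_add]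
  field_simp
end

section
/- For every fixed i with k+l ≤ i ≤ n and every h with k ≤ h ≤ n-l-2, the connection coefficients satisfy the three-term recurrence c_{ih} = F_i(h) c_{i,h+1} + G(h) c_{i,h+2}, where H(h) := (n-l-h-1)(h+k+β+2)/((n+l+α-h)(k-h-1)), F_i(h) := ((n-h)(h+1-k)/((n-l-h)(h+1))) · [1 - H(h) - (k+l-i)(i+k+l+σ)/((n+l+α-h)(k-h-1))], and G(h) := ((n-h-1)_2 (h+1-k)_2/((n-l-h-1)_2 (h+1)_2)) · H(h), with σ := α+β+1. (Recurrence of Theorem 3.2, computing c_{ih} for decreasing h.) -/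
open Finset

/-- The quantity `H(h)` of Theorem 3.2. -/
noncomputable def Hfun (α β : ℝ) (n k l h : ℕ) : ℝ :=
  ((n : ℝ) - l - h - 1) * ((h : ℝ) + k + β + 2) / (((n : ℝ) + l + α - h) * ((k : ℝ) - h - 1))

/-- The quantity `F_i(h)` of Theorem 3.2. -/
noncomputable def Ffun (α β : ℝ) (n k l i h : ℕ) : ℝ :=
  ((n : ℝ) - h) * ((h : ℝ) + 1 - k) / (((n : ℝ) - l - h) * ((h : ℝ) + 1)) *
    (1 - Hfun α β n k l h -
      ((k : ℝ) + l - i) * ((i : ℝ) + k + l + (α + β + 1)) /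
        (((n : ℝ) + l + α - h) * ((k : ℝ) - h - 1)))

/-- The quantity `G(h)` of Theorem 3.2. -/
noncomputable def Gfun (α β : ℝ) (n k l h : ℕ) : ℝ :=
  poch ((n : ℝ) - h - 1) 2 * poch ((h : ℝ) + 1 - k) 2 /
    (poch ((n : ℝ) - l - h - 1) 2 * poch ((h : ℝ) + 1) 2) * Hfun α β n k l h

theorem poch_succ (x : ℝ) (j : ℕ) : poch x (j + 1) = poch x j * (x + j) := by
  simp [poch, Finset.prod_range_succ]

theorem poch_succ_left (x : ℝ) (j : ℕ) : poch x (j + 1) = x * poch (x + 1) j := by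
  unfold poch
  rw [Finset.prod_range_succ', mul_comm]
  congr 1
  · simp
  · refine Finset.prod_congr rfl fun i _ => ?_
    push_cast
    ring

theorem poch_two (x : ℝ) : poch x 2 = x * (x + 1) := by
  simp [poch, Finset.prod_range_succ]

theorem poch_pos {x : ℝ} (hx : 0 < x) (j : ℕ) : 0 < poch x j :=
  Finset.prod_pos fun _ _ => by positivity

/-- The Hahn difference operator acting on the basis `(-x)_j`. -/
theorem hahn_operator_poch_succ (a b N x : ℝ) (j : ℕ) :
    (x + a + 1) * (x - N) * (poch (-(x + 1)) (j + 1) - poch (-x) (j + 1)) +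
        x * (x - b - N - 1) * (poch (-(x - 1)) (j + 1) - poch (-x) (j + 1)) =
      (j + 1) * (j + 1 + a + b + 1) * poch (-x) (j + 1) -
        (j + 1) * (j + 1 + a) * (j - N) * poch (-x) j := by
  have h1 : poch (-(x + 1)) (j + 1) = -(x + 1) * poch (-x) j := by
    rw [poch_succ_left, show -(x + 1) + 1 = -x by ring]
  have h2 : x * poch (-(x - 1)) (j + 1) = -(poch (-x) j * (-x + j) * (-x + j + 1)) := by
    have h := poch_succ_left (-x) (j + 1)
    rw [poch_succ, poch_succ, show -x + 1 = -(x - 1) by ring] at h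
    push_cast at h
    linarith
  rw [h1, poch_succ (-x) j]
  linear_combination (x - b - N - 1) * h2

/-- Partial sums of the Hahn difference equation telescope. -/
theorem hahn_partial_sum (m : ℕ) (a b x : ℝ) (ha : -1 < a) {N : ℕ} {c : ℕ → ℝ}
    (hc : ∀ j, c j = poch (-(m : ℝ)) j * poch ((m : ℝ) + a + b + 1) j /
      ((Nat.factorial j : ℝ) * poch (a + 1) j * poch (-(N : ℝ)) j))
    (M : ℕ) (hM : M ≤ N) :
    ∑ j ∈ Finset.range (M + 1), c j *
        ((x + a + 1) * (x - N) * (poch (-(x + 1)) j - poch (-x) j) +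
          x * (x - b - N - 1) * (poch (-(x - 1)) j - poch (-x) j) -
          m * (m + a + b + 1) * poch (-x) j) =
      c M * ((M - m) * (M + m + a + b + 1)) * poch (-x) M := by
  induction M with
  | zero =>
    simp [poch]
  | succ M ih =>
    rw [Finset.sum_range_succ, ih (by omega), hahn_operator_poch_succ]
    have hrec : c (M + 1) * ((M + 1) * (M + 1 + a) * (M - N)) =
        c M * ((M - m) * (M + m + a + b + 1)) := by
      have h1 : (0 : ℝ) < a + 1 + M := by
        have : (0 : ℝ) ≤ M := M.cast_nonneg
        linarith
      have h2 : (-(N : ℝ) + M) ≠ 0 := by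
        have : (M : ℝ) < N := by exact_mod_cast hM
        linarith
      have h3 := (poch_pos (show 0 < a + 1 by linarith) M).ne'
      have h4 := poch_neg_natCast_ne_zero (show M ≤ N by omega)
      have h5 : (Nat.factorial M : ℝ) ≠ 0 := by positivity
      have h6 := h1.ne'
      rw [hc, hc]
      simp only [poch_succ, Nat.factorial_succ]
      push_cast
      field_simp
      ring
    push_cast
    linear_combination -poch (-x) M * hrec

/-- The second-order difference equation of the Hahn polynomials. -/
theorem hahnQ_difference_equation {m N : ℕ} (hm : m ≤ N) (a b x : ℝ) (ha : -1 < a) :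
    (x + a + 1) * (x - N) * (hahnQ m (x + 1) a b N - hahnQ m x a b N) +
        x * (x - b - N - 1) * (hahnQ m (x - 1) a b N - hahnQ m x a b N) =
      m * (m + a + b + 1) * hahnQ m x a b N := by
  have h := hahn_partial_sum m a b x ha (N := N) (fun _ => rfl) m hm
  rw [sub_self, zero_mul, mul_zero, zero_mul] at h
  rw [← sub_eq_zero, ← h]
  simp only [hahnQ, ← Finset.sum_sub_distrib, Finset.mul_sum, ← Finset.sum_add_distrib]
  refine Finset.sum_congr rfl fun j _ => ?_
  ring

theorem inv_choose_mul_choose_succ {n N h r : ℕ} (hh : h < n) (hr : r < N) :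
    (n.choose h : ℝ)⁻¹ * (N.choose r : ℝ) =
      ((n : ℝ) - h) * (r + 1) / (((N : ℝ) - r) * (h + 1)) *
        ((n.choose (h + 1) : ℝ)⁻¹ * (N.choose (r + 1) : ℝ)) := by
  have key : ∀ {p q : ℕ}, q < p →
      (p.choose (q + 1) : ℝ) * (q + 1) = p.choose q * ((p : ℝ) - q) := by
    intro p q hq
    have h := Nat.choose_succ_right_eq p q
    rw [← Nat.cast_sub hq.le]
    exact_mod_cast h
  have h1 := key hh
  have h2 := key hr
  have hn : (n.choose h : ℝ) ≠ 0 := by exact_mod_cast (Nat.choose_pos hh.le).ne'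
  have hn' : (n.choose (h + 1) : ℝ) ≠ 0 := by exact_mod_cast (Nat.choose_pos hh).ne'
  have hN : (N : ℝ) - r ≠ 0 := by
    have : (r : ℝ) < N := by exact_mod_cast hr
    linarith
  have hh1 : (h : ℝ) + 1 ≠ 0 := by positivity
  field_simp
  linear_combination (N.choose r : ℝ) * ((N : ℝ) - r) * h1 - (n.choose h : ℝ) * ((n : ℝ) - h) * h2

/-- Recurrence of Theorem 3.2: computing `c_{ih}` for decreasing `h`. -/
theorem cCoef_recurrence_in_h (α β : ℝ) (hα : -1 < α) (hβ : -1 < β)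
    (n k l : ℕ) (hkl : k + l ≤ n) :
    ∀ i : ℕ, k + l ≤ i → i ≤ n → ∀ h : ℕ, k ≤ h → h + 2 ≤ n - l →
      cCoef α β n k l i h =
        Ffun α β n k l i h * cCoef α β n k l i (h + 1) +
          Gfun α β n k l h * cCoef α β n k l i (h + 2) := by
  intro i hi hin h hkh hhn
  obtain ⟨m, rfl⟩ := Nat.exists_eq_add_of_le hi
  obtain ⟨r, rfl⟩ := Nat.exists_eq_add_of_le hkh
  obtain ⟨s, rfl⟩ : ∃ s, n = k + l + (r + (s + 2)) := ⟨n - (k + l + r + 2), by omega⟩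
  have e1 : k + l + m - k - l = m := by omega
  have e2 : k + l + (r + (s + 2)) - k - l = r + (s + 2) := by omega
  have e3 : k + r - k = r := by omega
  have e4 : k + r + 1 - k = r + 1 := by omega
  have e5 : k + r + 2 - k = r + 2 := by omega
  have ha : -1 < α + 2 * l := by
    have : (0 : ℝ) ≤ l := l.cast_nonneg
    linarith
  have hQ := hahnQ_difference_equation (show m ≤ r + (s + 2) by omega)
    (α + 2 * l) (β + 2 * k) (s + 1) ha
  have c1 := inv_choose_mul_choose_succ (n := k + l + (r + (s + 2))) (N := r + (s + 2))
    (h := k + r) (r := r) (by omega) (by omega)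
  have c2 := inv_choose_mul_choose_succ (n := k + l + (r + (s + 2))) (N := r + (s + 2))
    (h := k + r + 1) (r := r + 1) (by omega) (by omega)
  have hr : (r : ℝ) + 1 ≠ 0 := by positivity
  have hs : (s : ℝ) + 2 + α + 2 * l ≠ 0 := by
    have : (0 : ℝ) ≤ s := s.cast_nonneg
    linarith
  have hden : ((s : ℝ) + 2 + α + 2 * l) * (-(r + 1)) ≠ 0 := mul_ne_zero hs (neg_ne_zero.2 hr)
  have hH : Hfun α β (k + l + (r + (s + 2))) k l (k + r) =
      ((s : ℝ) + 1) * (2 * k + r + β + 2) / ((s + 2 + α + 2 * l) * (-(r + 1))) := by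
    unfold Hfun
    push_cast
    congr 1 <;> ring
  have hF : Ffun α β (k + l + (r + (s + 2))) k l (k + l + m) (k + r) =
      ((l : ℝ) + s + 2) * (r + 1) / ((s + 2) * (k + r + 1)) *
        (1 - ((s : ℝ) + 1) * (2 * k + r + β + 2) / ((s + 2 + α + 2 * l) * (-(r + 1))) +
          m * (m + (α + 2 * l) + (β + 2 * k) + 1) / ((s + 2 + α + 2 * l) * (-(r + 1)))) := by
    rw [Ffun, hH, sub_eq_add_neg (1 - _) (_ / _), ← neg_div]
    push_cast
    congr 2
    · ring
    · ring
    · congr 1 <;> ring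
  have hG : Gfun α β (k + l + (r + (s + 2))) k l (k + r) =
      (((l : ℝ) + s + 2) * (r + 1) / ((s + 2) * (k + r + 1))) *
        (((l : ℝ) + s + 1) * (r + 2) / ((s + 1) * (k + r + 2))) *
        (((s : ℝ) + 1) * (2 * k + r + β + 2) / ((s + 2 + α + 2 * l) * (-(r + 1)))) := by
    rw [Gfun, hH]
    congr 1
    rw [div_mul_div_comm]
    congr 1 <;>
    · simp only [poch_two]
      push_cast
      ring
  rw [hF, hG]
  unfold cCoef
  rw [e1, e2, e3, e4, e5]
  have t0 : ((k + l + (r + (s + 2)) : ℕ) : ℝ) - l - (k + r : ℕ) = s + 1 + 1 := by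
    push_cast; ring
  have t1 : ((k + l + (r + (s + 2)) : ℕ) : ℝ) - l - (k + r + 1 : ℕ) = s + 1 := by
    push_cast; ring
  have t2 : ((k + l + (r + (s + 2)) : ℕ) : ℝ) - l - (k + r + 2 : ℕ) = s + 1 - 1 := by
    push_cast; ring
  rw [t0, t1, t2]
  have a1 : (((k + l + (r + (s + 2)) : ℕ) : ℝ) - (k + r : ℕ)) * (r + 1) /
      ((((r + (s + 2) : ℕ) : ℝ) - r) * ((k + r : ℕ) + 1)) =
      ((l : ℝ) + s + 2) * (r + 1) / ((s + 2) * (k + r + 1)) := by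
    push_cast
    congr 1 <;> ring
  have a2 : (((k + l + (r + (s + 2)) : ℕ) : ℝ) - (k + r + 1 : ℕ)) * ((r + 1 : ℕ) + 1) /
      ((((r + (s + 2) : ℕ) : ℝ) - (r + 1 : ℕ)) * ((k + r + 1 : ℕ) + 1)) =
      ((l : ℝ) + s + 1) * (r + 2) / ((s + 1) * (k + r + 2)) := by
    push_cast
    congr 1 <;> ring
  rw [a1] at c1
  rw [a2] at c2
  have hcore : hahnQ m ((s : ℝ) + 1 + 1) (α + 2 * l) (β + 2 * k) (r + (s + 2)) =
      (1 - ((s : ℝ) + 1) * (2 * k + r + β + 2) / ((s + 2 + α + 2 * l) * (-(r + 1))) +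
          m * (m + (α + 2 * l) + (β + 2 * k) + 1) / ((s + 2 + α + 2 * l) * (-(r + 1)))) *
        hahnQ m ((s : ℝ) + 1) (α + 2 * l) (β + 2 * k) (r + (s + 2)) +
      ((s : ℝ) + 1) * (2 * k + r + β + 2) / ((s + 2 + α + 2 * l) * (-(r + 1))) *
        hahnQ m ((s : ℝ) + 1 - 1) (α + 2 * l) (β + 2 * k) (r + (s + 2)) := by
    rw [one_sub_div hden, ← add_div, div_mul_eq_mul_div, div_mul_eq_mul_div, ← add_div,
      eq_div_iff hden]
    push_cast at hQ
    linear_combination hQ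
  simp only [mul_assoc (poch (α + 2 * l + 1) m / (Nat.factorial m : ℝ))]
  rw [c1, c2, hcore]
  ring
end
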